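/- arXiv:1906.10235 — 2 statements merged into one kernel-verified Lean document; each statement's English description precedes it below -/
import Mathlib

section
/- Let v : ℂⁿ → ℝ be twice differentiable at a point z, and suppose the real Hessian D²v(z) (a 2n × 2n real symmetric matrix under the identification ℂⁿ ≅ ℝ²ⁿ) is negative semidefinite at z. Then det(−D²v(z)) ≤ 2^{2n} · (det H(z))², where H(z) is the complex Hessian of v at z. (Since D²v(z) ≤ 0, H(z) is a negative semidefinite Hermitian matrix, so det H(z) is real.) -/
open Metric

/-- Second partial derivative `∂²v/∂e_a ∂e_b` of `v : ℝ²ⁿ → ℝ` at `x`, where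
`ℝ²ⁿ = EuclideanSpace ℝ (Fin n ⊕ Fin n)` is the identification of `ℂⁿ` with
`ℝ²ⁿ` via `z_j = x_j + i y_j` (`inl j ↦ x_j`, `inr j ↦ y_j`). -/
noncomputable def secondPartial (n : ℕ) (v : EuclideanSpace ℝ (Fin n ⊕ Fin n) → ℝ)
    (x : EuclideanSpace ℝ (Fin n ⊕ Fin n)) (a b : Fin n ⊕ Fin n) : ℝ :=
  fderiv ℝ (fun y => fderiv ℝ v y (EuclideanSpace.single b 1)) x
    (EuclideanSpace.single a 1)

/-- The real Hessian `D²v(x)`, a `2n × 2n` real matrix. -/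
noncomputable def realHessianC (n : ℕ) (v : EuclideanSpace ℝ (Fin n ⊕ Fin n) → ℝ)
    (x : EuclideanSpace ℝ (Fin n ⊕ Fin n)) :
    Matrix (Fin n ⊕ Fin n) (Fin n ⊕ Fin n) ℝ :=
  Matrix.of fun a b => secondPartial n v x a b

/-- The complex Hessian `H(x)` with entries
`H_{jk} = ∂²v/∂z_j∂z̄_k
  = (1/4)[∂²v/∂x_j∂x_k + ∂²v/∂y_j∂y_k + i(∂²v/∂x_j∂y_k − ∂²v/∂y_j∂x_k)]`. -/
noncomputable def complexHessian (n : ℕ) (v : EuclideanSpace ℝ (Fin n ⊕ Fin n) → ℝ)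
    (x : EuclideanSpace ℝ (Fin n ⊕ Fin n)) : Matrix (Fin n) (Fin n) ℂ :=
  Matrix.of fun j k =>
    (1 / 4 : ℂ) *
      (((secondPartial n v x (Sum.inl j) (Sum.inl k) +
          secondPartial n v x (Sum.inr j) (Sum.inr k) : ℝ) : ℂ) +
        Complex.I *
          ((secondPartial n v x (Sum.inl j) (Sum.inr k) -
            secondPartial n v x (Sum.inr j) (Sum.inl k) : ℝ) : ℂ))

open Matrix in
theorem Matrix.PosSemidef.four_pow_mul_det_le_sq_det_one_add {ι : Type*} [Fintype ι] [DecidableEq ι]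
    {K : Matrix ι ι ℝ} (hK : K.PosSemidef) :
    4 ^ Fintype.card ι * K.det ≤ (1 + K).det ^ 2 := by
  have hdet : (1 + K).det = ∏ i, (1 + hK.1.eigenvalues i) := by
    have h := hK.1.charpoly_eq
    apply_fun Polynomial.eval (-1) at h
    rw [eval_charpoly, Polynomial.eval_prod] at h
    have h1 : scalar ι (-1 : ℝ) - K = -(1 + K) := by
      rw [map_neg, map_one]; abel
    have h2 : ∀ i, Polynomial.eval (-1 : ℝ)
        (Polynomial.X - Polynomial.C ((hK.1.eigenvalues i : ℝ))) =
        (-1) * (1 + hK.1.eigenvalues i) := by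
      intro i; simp; ring
    simp only [RCLike.ofReal_real_eq_id, id_eq] at h
    rw [h1, det_neg, Finset.prod_congr rfl fun i _ => h2 i, Finset.prod_mul_distrib,
      Finset.prod_const, Finset.card_univ] at h
    exact mul_left_cancel₀ (pow_ne_zero _ (by norm_num)) h
  rw [hdet, hK.1.det_eq_prod_eigenvalues, ← Finset.prod_pow, ← Finset.card_univ,
    ← Finset.prod_const, ← Finset.prod_mul_distrib]
  refine Finset.prod_le_prod (fun i _ => ?_) fun i _ => ?_
  · simpa using hK.eigenvalues_nonneg i
  · simp only [RCLike.ofReal_real_eq_id, id_eq]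
    nlinarith [sq_nonneg (1 - hK.1.eigenvalues i)]

open Matrix MatrixOrder in
/-- The arithmetic-geometric mean inequality for determinants. -/
theorem Matrix.PosSemidef.four_pow_mul_det_mul_det_le_sq_det_add {ι : Type*} [Fintype ι]
    [DecidableEq ι] {A B : Matrix ι ι ℝ} (hA : A.PosSemidef) (hB : B.PosSemidef) :
    4 ^ Fintype.card ι * (A.det * B.det) ≤ (A + B).det ^ 2 := by
  by_cases h0 : A.det = 0
  · simpa [h0] using sq_nonneg _
  obtain ⟨S, rfl⟩ := CStarAlgebra.nonneg_iff_eq_star_mul_self.mp hA.nonneg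
  have hS : IsUnit S.det := by
    rw [isUnit_iff_ne_zero]
    intro h
    simp [h] at h0
  set K := S⁻¹ᴴ * B * S⁻¹ with hKdef
  have hK : K.PosSemidef := hB.conjTranspose_mul_mul_same _
  have hB' : B = Sᴴ * K * S := by
    have h1 : Sᴴ * S⁻¹ᴴ = 1 := by
      rw [← conjTranspose_mul, nonsing_inv_mul _ hS, conjTranspose_one]
    rw [hKdef]
    calc
      B = (Sᴴ * S⁻¹ᴴ) * B * (S⁻¹ * S) := by
        rw [h1, nonsing_inv_mul _ hS, Matrix.one_mul, Matrix.mul_one]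
      _ = _ := by simp only [Matrix.mul_assoc]
  have hsum : star S * S + B = Sᴴ * (1 + K) * S := by
    rw [hB', Matrix.mul_add, Matrix.add_mul, Matrix.mul_one]; rfl
  have hSt : Sᴴ.det = S.det := by simp
  have key := mul_le_mul_of_nonneg_left hK.four_pow_mul_det_le_sq_det_one_add
    (sq_nonneg (S.det ^ 2))
  rw [hsum, hB', star_eq_conjTranspose]
  simp only [det_mul, hSt]
  linarith

open Matrix in
theorem Matrix.det_fromBlocks_self_neg_eq_normSq {ι : Type*} [Fintype ι] [DecidableEq ι]
    (X Y : Matrix ι ι ℝ) :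
    (fromBlocks X Y (-Y) X).det =
      Complex.normSq (X.map Complex.ofReal + Complex.I • Y.map Complex.ofReal).det := by
  set P := X.map Complex.ofReal with hP
  set Q := Y.map Complex.ofReal with hQ
  have hmap : (fromBlocks X Y (-Y) X).map Complex.ofReal = fromBlocks P Q (-Q) P := by
    rw [fromBlocks_map, Matrix.map_neg _ (fun a => Complex.ofReal_neg a)]
  have hfac : fromBlocks 1 (-(Complex.I • 1)) 0 1 * fromBlocks P Q (-Q) P *
      fromBlocks 1 (Complex.I • 1) 0 1 =
      fromBlocks (P + Complex.I • Q) 0 (-Q) (P - Complex.I • Q) := by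
    simp only [fromBlocks_multiply, Matrix.one_mul, Matrix.mul_one, Matrix.zero_mul,
      Matrix.mul_zero, Matrix.neg_mul, Matrix.mul_neg, Matrix.smul_mul, Matrix.mul_smul, smul_add,
      smul_neg, smul_smul, Complex.I_mul_I, neg_neg, zero_add, add_zero, neg_smul, one_smul]
    congr 1 <;> abel
  have hconj : (P - Complex.I • Q) = (P + Complex.I • Q).map (starRingEnd ℂ) := by
    ext i j
    simp [hP, hQ, sub_eq_add_neg]
  have hdet := congrArg det hfac
  rw [det_mul, det_mul, det_fromBlocks_zero₂₁, det_fromBlocks_zero₂₁, det_fromBlocks_zero₁₂,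
    hconj, ← RingHom.mapMatrix_apply, ← RingHom.map_det, Complex.mul_conj, ← hmap] at hdet
  simp only [det_one, one_mul, mul_one] at hdet
  have h := RingHom.map_det Complex.ofRealHom (fromBlocks X Y (-Y) X)
  rw [RingHom.mapMatrix_apply] at h
  exact Complex.ofReal_injective (h.trans hdet)

open Matrix in
theorem Matrix.PosSemidef.four_pow_mul_det_le_normSq_det {ι : Type*} [Fintype ι] [DecidableEq ι]
    {A B C D : Matrix ι ι ℝ} (hM : (fromBlocks A B C D).PosSemidef) :
    4 ^ Fintype.card ι * (fromBlocks A B C D).det ≤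
      Complex.normSq
        ((A + D).map Complex.ofReal + Complex.I • (B - C).map Complex.ofReal).det := by
  set M := fromBlocks A B C D
  set J : Matrix (ι ⊕ ι) (ι ⊕ ι) ℝ := fromBlocks 0 1 (-1) 0 with hJ
  have hJt : Jᴴ = fromBlocks 0 (-1) 1 0 := by
    simp [hJ, fromBlocks_transpose]
  have hJJ : Jᴴ * J = 1 := by
    rw [hJt, hJ]
    simp [fromBlocks_multiply]
  have hJM : Jᴴ * M * J = fromBlocks D (-C) (-B) A := by
    rw [hJt, hJ]
    simp [M, fromBlocks_multiply]
  have hdet : (Jᴴ * M * J).det = M.det := by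
    rw [det_mul_right_comm, hJJ, Matrix.one_mul]
  have hsum : M + Jᴴ * M * J = fromBlocks (A + D) (B - C) (-(B - C)) (A + D) := by
    rw [hJM, fromBlocks_add]
    congr 1 <;> abel
  have key := hM.four_pow_mul_det_mul_det_le_sq_det_add (hM.conjTranspose_mul_mul_same J)
  rw [hdet, hsum, det_fromBlocks_self_neg_eq_normSq, Fintype.card_sum, ← two_mul, pow_mul'] at key
  refine le_of_sq_le_sq ?_ (Complex.normSq_nonneg _)
  linarith

/-- Blocki's pointwise inequality: if `v : ℂⁿ ≅ ℝ²ⁿ → ℝ` is twice differentiable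
at `z` and its real Hessian `D²v(z)` is negative semidefinite there, then
`det(−D²v(z)) ≤ 2^{2n} (det H(z))²`, where `H(z)` is the complex Hessian; since
`H(z)` is negative semidefinite Hermitian, `(det H(z))²` is `|det H(z)|²`. -/
theorem blocki_pointwise_inequality (n : ℕ)
    (v : EuclideanSpace ℝ (Fin n ⊕ Fin n) → ℝ)
    (z : EuclideanSpace ℝ (Fin n ⊕ Fin n))
    (hv : DifferentiableAt ℝ v z)
    (hv' : DifferentiableAt ℝ (fderiv ℝ v) z)
    (hneg : Matrix.PosSemidef (-(realHessianC n v z))) :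
    (-(realHessianC n v z)).det ≤
      (2 : ℝ) ^ (2 * n) * Complex.normSq (complexHessian n v z).det := by
  set M := -(realHessianC n v z) with hM
  have hneg' := hneg
  rw [← Matrix.fromBlocks_toBlocks M] at hneg'
  have key := hneg'.four_pow_mul_det_le_normSq_det
  rw [Matrix.fromBlocks_toBlocks, Fintype.card_fin] at key
  have hH : (M.toBlocks₁₁ + M.toBlocks₂₂).map Complex.ofReal +
      Complex.I • (M.toBlocks₁₂ - M.toBlocks₂₁).map Complex.ofReal =
      (-4 : ℂ) • complexHessian n v z := by
    ext i j
    simp [hM, Matrix.toBlocks₁₁, Matrix.toBlocks₁₂, Matrix.toBlocks₂₁, Matrix.toBlocks₂₂,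
      realHessianC, complexHessian]
    ring
  have h4 : Complex.normSq (-4) = 4 * 4 := by
    rw [Complex.normSq_neg, Complex.normSq_ofNat]
  rw [hH, Matrix.det_smul, Fintype.card_fin, map_mul, map_pow, h4, mul_pow, mul_assoc] at key
  rw [pow_mul, show (2 : ℝ) ^ 2 = 4 by norm_num]
  exact le_of_mul_le_mul_left key (by positivity)
end

section
/- Let n ≥ 1 and let h : ℝ² → Matrix (Fin n) (Fin n) ℂ be a twice continuously differentiable matrix-valued function such that h(x, y) is invertible for all (x, y). Then the mixed second partial derivative of det ∘ h satisfies, at every point: ∂_x ∂_y (det h) = (det h) · Tr(h⁻¹ · ∂_x ∂_y h) − (det h) · Tr(h⁻¹ · (∂_x h) · h⁻¹ · (∂_y h)) + (det h)⁻¹ · (∂_x det h) · (∂_y det h). -/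
/-- Partial derivative in the first (`x`) variable of `f : ℝ² → ℂ`. -/
noncomputable def partialX (f : ℝ × ℝ → ℂ) (p : ℝ × ℝ) : ℂ :=
  deriv (fun s => f (s, p.2)) p.1

/-- Partial derivative in the second (`y`) variable of `f : ℝ² → ℂ`. -/
noncomputable def partialY (f : ℝ × ℝ → ℂ) (p : ℝ × ℝ) : ℂ :=
  deriv (fun t => f (p.1, t)) p.2

/-- Entrywise partial derivative in `x` of a matrix-valued function. -/
noncomputable def partialXM (n : ℕ) (h : ℝ × ℝ → Matrix (Fin n) (Fin n) ℂ)
    (p : ℝ × ℝ) : Matrix (Fin n) (Fin n) ℂ :=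
  Matrix.of fun i j => partialX (fun q => h q i j) p

/-- Entrywise partial derivative in `y` of a matrix-valued function. -/
noncomputable def partialYM (n : ℕ) (h : ℝ × ℝ → Matrix (Fin n) (Fin n) ℂ)
    (p : ℝ × ℝ) : Matrix (Fin n) (Fin n) ℂ :=
  Matrix.of fun i j => partialY (fun q => h q i j) p

namespace Matrix

variable {m n l : Type*} [Fintype n] {x : ℝ}

/-- The product rule for matrices, entrywise. -/
theorem hasDerivAt_mul_apply {A : ℝ → Matrix m n ℂ} {B : ℝ → Matrix n l ℂ}
    {A' : Matrix m n ℂ} {B' : Matrix n l ℂ}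
    (hA : ∀ i j, HasDerivAt (fun t => A t i j) (A' i j) x)
    (hB : ∀ i j, HasDerivAt (fun t => B t i j) (B' i j) x) (i : m) (j : l) :
    HasDerivAt (fun t => (A t * B t) i j) ((A' * B x + A x * B') i j) x := by
  simp only [mul_apply, add_apply, ← Finset.sum_add_distrib]
  exact HasDerivAt.fun_sum fun k _ => (hA i k).mul (hB k j)

theorem hasDerivAt_trace {A : ℝ → Matrix n n ℂ} {A' : Matrix n n ℂ}
    (hA : ∀ i j, HasDerivAt (fun t => A t i j) (A' i j) x) :
    HasDerivAt (fun t => (A t).trace) A'.trace x :=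
  HasDerivAt.fun_sum fun i _ => hA i i

variable [DecidableEq n]

/-- Jacobi's formula for the derivative of a determinant. -/
theorem hasDerivAt_det {A : ℝ → Matrix n n ℂ} {A' : Matrix n n ℂ}
    (hA : ∀ i j, HasDerivAt (fun t => A t i j) (A' i j) x) :
    HasDerivAt (fun t => (A t).det) ((A x).adjugate * A').trace x := by
  have key : ((A x).adjugate * A').trace = ∑ σ : Equiv.Perm n,
      ((Equiv.Perm.sign σ : ℤ) : ℂ) *
        ∑ i, (∏ j ∈ Finset.univ.erase i, A x (σ j) j) • A' (σ i) i := by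
    have h1 : ((A x).adjugate * A').trace =
        ∑ i, ((A x).updateCol i fun k => A' k i).det := by
      refine Finset.sum_congr rfl fun i _ => ?_
      rw [← cramer_apply, cramer_eq_adjugate_mulVec]
      rfl
    simp only [h1, det_apply', Finset.mul_sum]
    rw [Finset.sum_comm]
    refine Finset.sum_congr rfl fun σ _ => Finset.sum_congr rfl fun i _ => ?_
    rw [← Finset.prod_erase_mul _ _ (Finset.mem_univ i), updateCol_self, smul_eq_mul]
    congr 2
    exact Finset.prod_congr rfl fun j hj => updateCol_ne (Finset.ne_of_mem_erase hj)
  simp only [key, det_apply']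
  exact HasDerivAt.fun_sum fun σ _ =>
    (HasDerivAt.fun_finsetProd fun i _ => hA (σ i) i).const_mul _

theorem differentiableAt_det {A : ℝ → Matrix n n ℂ}
    (hA : ∀ i j, DifferentiableAt ℝ (fun t => A t i j) x) :
    DifferentiableAt ℝ (fun t => (A t).det) x :=
  (hasDerivAt_det (A' := of fun i j => deriv (fun t => A t i j) x)
    fun i j => (hA i j).hasDerivAt).differentiableAt

theorem differentiableAt_inv_apply {A : ℝ → Matrix n n ℂ}
    (hA : ∀ i j, DifferentiableAt ℝ (fun t => A t i j) x) (hdet : (A x).det ≠ 0) (i j : n) :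
    DifferentiableAt ℝ (fun t => (A t)⁻¹ i j) x := by
  simp only [inv_def, smul_apply, Ring.inverse_eq_inv', smul_eq_mul, adjugate_apply]
  refine ((differentiableAt_det hA).inv hdet).mul (differentiableAt_det fun a b => ?_)
  by_cases h : a = j
  · subst h
    simp
  · simpa [updateRow_ne h] using hA a b

/-- The derivative of the inverse of an invertible matrix, entrywise. -/
theorem hasDerivAt_inv_apply {A : ℝ → Matrix n n ℂ} {A' : Matrix n n ℂ}
    (hA : ∀ i j, HasDerivAt (fun t => A t i j) (A' i j) x) (hdet : ∀ t, IsUnit (A t).det)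
    (i j : n) :
    HasDerivAt (fun t => (A t)⁻¹ i j) ((-((A x)⁻¹ * A' * (A x)⁻¹)) i j) x := by
  set B' : Matrix n n ℂ := of fun i j => deriv (fun t => (A t)⁻¹ i j) x
  have hB : ∀ i j, HasDerivAt (fun t => (A t)⁻¹ i j) (B' i j) x := fun i j =>
    (differentiableAt_inv_apply (fun a b => (hA a b).differentiableAt)
      (hdet x).ne_zero i j).hasDerivAt
  have hzero : B' * A x + (A x)⁻¹ * A' = 0 := by
    ext a b
    refine (hasDerivAt_mul_apply hB hA a b).unique ?_
    simpa only [nonsing_inv_mul _ (hdet _), zero_apply] using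
      hasDerivAt_const x ((1 : Matrix n n ℂ) a b)
  have hB' : B' = -((A x)⁻¹ * A' * (A x)⁻¹) := by
    rw [← mul_nonsing_inv_cancel_right (A x) B' (hdet x), eq_neg_of_add_eq_zero_left hzero,
      Matrix.neg_mul]
  exact hB' ▸ hB i j

/-- Jacobi's formula for the derivative of the determinant of an invertible matrix. -/
theorem hasDerivAt_det_of_isUnit {A : ℝ → Matrix n n ℂ} {A' : Matrix n n ℂ}
    (hA : ∀ i j, HasDerivAt (fun t => A t i j) (A' i j) x) (hdet : IsUnit (A x).det) :
    HasDerivAt (fun t => (A t).det) ((A x).det * ((A x)⁻¹ * A').trace) x := by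
  convert hasDerivAt_det hA using 1
  rw [inv_def, Matrix.smul_mul, trace_smul, smul_eq_mul, Ring.mul_inverse_cancel_left _ _ hdet]

end Matrix

theorem hasDerivAt_partialX {f : ℝ × ℝ → ℂ} (hf : Differentiable ℝ f) (p : ℝ × ℝ) :
    HasDerivAt (fun s => f (s, p.2)) (partialX f p) p.1 :=
  DifferentiableAt.hasDerivAt (by fun_prop)

theorem hasDerivAt_partialY {f : ℝ × ℝ → ℂ} (hf : Differentiable ℝ f) (p : ℝ × ℝ) :
    HasDerivAt (fun t => f (p.1, t)) (partialY f p) p.2 :=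
  DifferentiableAt.hasDerivAt (by fun_prop)

theorem differentiable_partialY {f : ℝ × ℝ → ℂ} (hf : ContDiff ℝ 2 f) :
    Differentiable ℝ (partialY f) := by
  have hfd : Differentiable ℝ f := hf.differentiable (by norm_num)
  have heq : partialY f = fun p => fderiv ℝ f p (0, 1) := by
    ext p
    exact ((hfd p).hasFDerivAt.comp_hasDerivAt p.2
      ((hasDerivAt_const p.2 p.1).prodMk (hasDerivAt_id p.2))).deriv
  rw [heq]
  exact ((hf.fderiv_right (m := 1) (by norm_num)).differentiable (by norm_num)).clm_apply
    (differentiable_const _)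

/-- Second variation of the determinant (equation (3.22) of the paper): if
`h : ℝ² → Matrix (Fin n) (Fin n) ℂ` is `C²` (entrywise) and pointwise invertible,
then `∂_x ∂_y det h = (det h) Tr(h⁻¹ ∂_x∂_y h) − (det h) Tr(h⁻¹ ∂_x h · h⁻¹ ∂_y h)
+ (det h)⁻¹ (∂_x det h)(∂_y det h)`. -/
theorem second_derivative_of_det (n : ℕ) (hn : 1 ≤ n)
    (h : ℝ × ℝ → Matrix (Fin n) (Fin n) ℂ)
    (hsmooth : ∀ i j : Fin n, ContDiff ℝ 2 (fun p => h p i j))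
    (hinv : ∀ p : ℝ × ℝ, IsUnit (h p)) :
    ∀ p : ℝ × ℝ,
      partialX (fun q => partialY (fun r => (h r).det) q) p =
        (h p).det * ((h p)⁻¹ * partialXM n (fun q => partialYM n h q) p).trace -
          (h p).det *
            ((h p)⁻¹ * partialXM n h p * (h p)⁻¹ * partialYM n h p).trace +
          ((h p).det)⁻¹ * partialX (fun q => (h q).det) p *
            partialY (fun q => (h q).det) p := by
  intro p
  have hd : ∀ i j, Differentiable ℝ (fun p => h p i j) := fun i j =>
    (hsmooth i j).differentiable (by norm_num)
  have hu : ∀ q, IsUnit (h q).det := fun q => (Matrix.isUnit_iff_isUnit_det _).1 (hinv q)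
  have hX : ∀ i j, HasDerivAt (fun s => h (s, p.2) i j) (partialXM n h p i j) p.1 :=
    fun i j => hasDerivAt_partialX (hd i j) p
  have hXY : ∀ i j, HasDerivAt (fun s => partialYM n h (s, p.2) i j)
      (partialXM n (fun q => partialYM n h q) p i j) p.1 :=
    fun i j => hasDerivAt_partialX (differentiable_partialY (hsmooth i j)) p
  have hdetY : ∀ q, partialY (fun r => (h r).det) q =
      (h q).det * ((h q)⁻¹ * partialYM n h q).trace := fun q =>
    (Matrix.hasDerivAt_det_of_isUnit (A := fun t => h (q.1, t))
      (fun i j => hasDerivAt_partialY (hd i j) q) (hu q)).deriv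
  have hdetX := Matrix.hasDerivAt_det_of_isUnit (A := fun s => h (s, p.2)) hX (hu p)
  have hdetX' : partialX (fun r => (h r).det) p =
      (h p).det * ((h p)⁻¹ * partialXM n h p).trace := hdetX.deriv
  have htr := Matrix.hasDerivAt_trace (Matrix.hasDerivAt_mul_apply
    (Matrix.hasDerivAt_inv_apply (A := fun s => h (s, p.2)) hX fun s => hu (s, p.2)) hXY)
  have hmain := (hdetX.mul htr).deriv
  have hne : (h p).det ≠ 0 := (hu p).ne_zero
  simp only [hdetY, hdetX']
  refine hmain.trans ?_
  simp only [Prod.mk.eta, Matrix.trace_add, Matrix.neg_mul, Matrix.trace_neg]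
  field_simp
  ring
end
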